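/- arXiv:1306.3379 — 7 statements merged into one kernel-verified Lean document; each statement's English description precedes it below -/
import Mathlib

section
/- For all integers a, b ≥ 0 and k with a + b ≤ k, one has ∑_{j=a}^{k−b} (−1)^j · C(j,a) · C(k−j,b) · C(k+1,j+1) = (−1)^a · C(k+1,b). -/
theorem aux_T (a m : ℕ) :
    ∑ i ∈ Finset.range (m + 2), (-1 : ℤ) ^ (a + i) * ((a + i).choose a : ℤ) *
      ((a + m + 1).choose (a + i) : ℤ) = 0 := by
  have h := Int.alternating_sum_range_choose_of_ne (n := m + 1) (by omega)
  have : ∀ i ∈ Finset.range (m + 2), (-1 : ℤ) ^ (a + i) * ((a + i).choose a : ℤ) *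
      ((a + m + 1).choose (a + i) : ℤ) =
      ((-1) ^ a * ((a + m + 1).choose a : ℤ)) * ((-1) ^ i * ((m + 1).choose i : ℤ)) := by
    intro i hi
    have hi' := Finset.mem_range.1 hi
    have h1 := Nat.choose_mul (n := a + m + 1) (k := a + i) (s := a) (by omega)
    rw [show a + m + 1 - a = m + 1 by omega, show a + i - a = i by omega] at h1
    have h2 : ((a + m + 1).choose (a + i) : ℤ) * ((a + i).choose a : ℤ) =
      ((a + m + 1).choose a : ℤ) * ((m + 1).choose i : ℤ) := by exact_mod_cast h1
    rw [pow_add]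
    linear_combination (-1 : ℤ) ^ a * (-1) ^ i * h2
  rw [Finset.sum_congr rfl this, ← Finset.mul_sum, h, mul_zero]

theorem aux_S (a m : ℕ) :
    ∑ i ∈ Finset.range (m + 1), (-1 : ℤ) ^ (a + i) * ((a + i).choose a : ℤ) *
      ((a + m + 1).choose (a + i + 1) : ℤ) = (-1) ^ a := by
  induction m with
  | zero => simp
  | succ m ih =>
    have h := aux_T a m
    have e : ∀ i, ((a + (m + 1) + 1).choose (a + i + 1) : ℤ) =
        ((a + m + 1).choose (a + i) : ℤ) + ((a + m + 1).choose (a + i + 1) : ℤ) := by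
      intro i
      exact_mod_cast Nat.choose_succ_succ (a + m + 1) (a + i)
    simp only [e, mul_add, Finset.sum_add_distrib]
    rw [h, Finset.sum_range_succ, ih, Nat.choose_eq_zero_of_lt (show a + m + 1 < a + (m + 1) + 1 by omega)]
    simp

/-- Part (b) of the binomial Lemma: for `a, b ≥ 0` with `a + b ≤ k`,
`∑_{j=a}^{k−b} (−1)^j ⬝ C(j,a) ⬝ C(k−j,b) ⬝ C(k+1,j+1) = (−1)^a ⬝ C(k+1,b)`. -/
theorem binomial_identity_b (k a b : ℕ) (hab : a + b ≤ k) :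
    ∑ j ∈ Finset.Icc a (k - b),
        (-1 : ℤ) ^ j * (j.choose a : ℤ) * ((k - j).choose b : ℤ) * ((k + 1).choose (j + 1) : ℤ)
      = (-1 : ℤ) ^ a * ((k + 1).choose b : ℤ) := by
  obtain ⟨m, rfl⟩ := Nat.exists_eq_add_of_le hab
  rw [show Finset.Icc a (a + b + m - b) = Finset.Ico a (a + m + 1) by ext; simp; omega,
    Finset.sum_Ico_eq_sum_range, show a + m + 1 - a = m + 1 by omega, ← aux_S a m, Finset.sum_mul]
  refine Finset.sum_congr rfl fun i hi => ?_
  have hi' := Finset.mem_range.1 hi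
  have h1 := Nat.choose_mul (n := a + b + m + 1) (k := a + i + 1 + b) (s := b) (by omega)
  have h2 := Nat.choose_mul (n := a + b + m + 1) (k := a + i + 1 + b) (s := a + i + 1) (by omega)
  rw [show a + b + m + 1 - b = a + m + 1 by omega, Nat.add_sub_cancel] at h1
  rw [show a + b + m + 1 - (a + i + 1) = a + b + m - (a + i) by omega, Nat.add_sub_cancel_left,
    Nat.choose_symm_add, h1] at h2
  have h3 : ((a + b + m + 1).choose b : ℤ) * ((a + m + 1).choose (a + i + 1) : ℤ) =
    ((a + b + m + 1).choose (a + i + 1) : ℤ) * ((a + b + m - (a + i)).choose b : ℤ) := by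
    exact_mod_cast h2
  linear_combination -(-1 : ℤ) ^ (a + i) * ((a + i).choose a : ℤ) * h3
end

section
/- Let ρ^a_i : ℝ^m → ℝ (1 ≤ a ≤ m, 1 ≤ i ≤ r) and c^k_{ij} : ℝ^m → ℝ (1 ≤ i,j,k ≤ r) be smooth with c^k_{ij} = −c^k_{ji}, and let κ be the induced local algebroid relation on TE = ℝ^m × ℝ^r × ℝ^m × ℝ^r. Define Tρ : ℝ^m×ℝ^r×ℝ^m×ℝ^r → ℝ^{4m} by Tρ(x,y,ẋ,ẏ) = (x^a, ρ^a_i(x)y^i, ẋ^a, (∂ρ^a_i/∂x^b)(x)·ẋ^b·y^i + ρ^a_i(x)·ẏ^i), and let κ_M : ℝ^{4m} → ℝ^{4m} be the canonical flip κ_M(x,u,v,w) = (x,v,u,w). Then the following are equivalent: (i) for every κ-related pair (X,Y) one has κ_M(Tρ(X)) = Tρ(Y); (ii) for all x ∈ ℝ^m and all indices a, j, k: (∂ρ^a_k/∂x^b)(x)·ρ^b_j(x) − (∂ρ^a_j/∂x^b)(x)·ρ^b_k(x) = ρ^a_i(x)·c^i_{jk}(x) (summation over repeated indices). -/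
open scoped BigOperators

/-- Partial derivative `∂f/∂x^b` at `x` of a function `f : ℝ^m → ℝ`. -/
noncomputable def pderivCoord {m : ℕ} (f : (Fin m → ℝ) → ℝ) (b : Fin m) (x : Fin m → ℝ) : ℝ :=
  fderiv ℝ f x (Pi.single b 1)

/-- The local algebroid relation `κ` on `TE = ℝ^m × ℝ^r × ℝ^m × ℝ^r` induced by the structure
functions `ρ^a_i` and `c^k_{ij}`:  `(x,y,ẋ,ẏ)` and `(x̄,ȳ,ẋ̄,ẏ̄)` are `κ`-related iff
`x̄ = x`, `ẋ^a = ρ^a_j(x)ȳ^j`, `ẋ̄^a = ρ^a_j(x)y^j` and `ẏ̄^k = ẏ^k + c^k_{ij}(x)ȳ^i y^j`. -/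
def kappaRel {m r : ℕ} (ρ : Fin m → Fin r → (Fin m → ℝ) → ℝ)
    (c : Fin r → Fin r → Fin r → (Fin m → ℝ) → ℝ)
    (X Y : (Fin m → ℝ) × (Fin r → ℝ) × (Fin m → ℝ) × (Fin r → ℝ)) : Prop :=
  Y.1 = X.1 ∧
  (∀ a, X.2.2.1 a = ∑ j, ρ a j X.1 * Y.2.1 j) ∧
  (∀ a, Y.2.2.1 a = ∑ j, ρ a j X.1 * X.2.1 j) ∧
  (∀ k, Y.2.2.2 k = X.2.2.2 k + ∑ i, ∑ j, c k i j X.1 * Y.2.1 i * X.2.1 j)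

/-- The tangent lift `Tρ : TE → ℝ^{4m}` of the anchor,
`Tρ(x,y,ẋ,ẏ) = (x^a, ρ^a_i(x)y^i, ẋ^a, (∂ρ^a_i/∂x^b)(x)ẋ^b y^i + ρ^a_i(x)ẏ^i)`. -/
noncomputable def Trho {m r : ℕ} (ρ : Fin m → Fin r → (Fin m → ℝ) → ℝ)
    (X : (Fin m → ℝ) × (Fin r → ℝ) × (Fin m → ℝ) × (Fin r → ℝ)) :
    (Fin m → ℝ) × (Fin m → ℝ) × (Fin m → ℝ) × (Fin m → ℝ) :=
  (X.1,
   fun a => ∑ i, ρ a i X.1 * X.2.1 i,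
   X.2.2.1,
   fun a => (∑ i, (∑ b, pderivCoord (ρ a i) b X.1 * X.2.2.1 b) * X.2.1 i)
      + ∑ i, ρ a i X.1 * X.2.2.2 i)

/-- The canonical flip `κ_M : ℝ^{4m} → ℝ^{4m}`, `κ_M(x,u,v,w) = (x,v,u,w)`. -/
def canFlip {m : ℕ} (V : (Fin m → ℝ) × (Fin m → ℝ) × (Fin m → ℝ) × (Fin m → ℝ)) :
    (Fin m → ℝ) × (Fin m → ℝ) × (Fin m → ℝ) × (Fin m → ℝ) :=
  (V.1, V.2.2.1, V.2.1, V.2.2.2)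

theorem key_identity_aux {m r : ℕ} (D : Fin r → Fin m → ℝ) (R : Fin m → Fin r → ℝ)
    (p : Fin r → ℝ) (C : Fin r → Fin r → Fin r → ℝ) (y z : Fin r → ℝ) :
    (∑ i, (∑ b, D i b * ∑ j, R b j * z j) * y i)
      - (∑ i, (∑ b, D i b * ∑ j, R b j * y j) * z i)
      - (∑ i, p i * ∑ j, ∑ k, C i j k * z j * y k)
    = ∑ j, ∑ k, (∑ b, (D k b * R b j - D j b * R b k) - ∑ i, p i * C i j k) * (z j * y k) := by
  have h1 : (∑ i, (∑ b, D i b * ∑ j, R b j * z j) * y i)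
      = ∑ j, ∑ k, (∑ b, D k b * R b j) * (z j * y k) := by
    rw [Finset.sum_comm]
    refine Finset.sum_congr rfl fun k _ => ?_
    simp only [Finset.mul_sum, Finset.sum_mul]
    rw [Finset.sum_comm]
    refine Finset.sum_congr rfl fun j _ => Finset.sum_congr rfl fun b _ => ?_
    ring
  have h2 : (∑ i, (∑ b, D i b * ∑ j, R b j * y j) * z i)
      = ∑ j, ∑ k, (∑ b, D j b * R b k) * (z j * y k) := by
    refine Finset.sum_congr rfl fun k _ => ?_
    simp only [Finset.mul_sum, Finset.sum_mul]
    rw [Finset.sum_comm]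
    refine Finset.sum_congr rfl fun j _ => Finset.sum_congr rfl fun b _ => ?_
    ring
  have h3 : (∑ i, p i * ∑ j, ∑ k, C i j k * z j * y k)
      = ∑ j, ∑ k, (∑ i, p i * C i j k) * (z j * y k) := by
    simp only [Finset.mul_sum, Finset.sum_mul]
    rw [Finset.sum_comm]
    refine Finset.sum_congr rfl fun j _ => ?_
    rw [Finset.sum_comm]
    refine Finset.sum_congr rfl fun k _ => Finset.sum_congr rfl fun b _ => ?_
    ring
  rw [h1, h2, h3]
  simp only [Finset.sum_sub_distrib, sub_mul]

/-- The commutativity of `κ` with the canonical flip via `Tρ` is equivalent to the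
compatibility of the anchor and the bracket (axiom (b) of an almost Lie algebroid). -/
theorem flip_commutation_iff_anchor_bracket_compatibility {m r : ℕ}
    (ρ : Fin m → Fin r → (Fin m → ℝ) → ℝ)
    (c : Fin r → Fin r → Fin r → (Fin m → ℝ) → ℝ)
    (hρ : ∀ a i, ContDiff ℝ (⊤ : ℕ∞) (ρ a i))
    (hc : ∀ k i j, ContDiff ℝ (⊤ : ℕ∞) (c k i j))
    (hskew : ∀ k i j x, c k i j x = - c k j i x) :
    (∀ X Y, kappaRel ρ c X Y → canFlip (Trho ρ X) = Trho ρ Y) ↔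
    (∀ (x : Fin m → ℝ) (a : Fin m) (j k : Fin r),
      ∑ b, (pderivCoord (ρ a k) b x * ρ b j x - pderivCoord (ρ a j) b x * ρ b k x)
        = ∑ i, ρ a i x * c i j k x) := by
  constructor
  · intro h x a j k
    have h0 := h (x, Pi.single k 1, (fun a => ∑ l, ρ a l x * (Pi.single j 1 : Fin r → ℝ) l), 0)
      (x, Pi.single j 1, (fun a => ∑ l, ρ a l x * (Pi.single k 1 : Fin r → ℝ) l),
        fun q => 0 + ∑ s, ∑ t, c q s t x * (Pi.single j 1 : Fin r → ℝ) s
          * (Pi.single k 1 : Fin r → ℝ) t)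
      ⟨rfl, fun _ => rfl, fun _ => rfl, fun _ => rfl⟩
    have h1 := congrFun (congrArg (fun V => V.2.2.2) h0) a
    have h2 := key_identity_aux (fun i b => pderivCoord (ρ a i) b x) (fun b j => ρ b j x)
      (fun i => ρ a i x) (fun i j k => c i j k x) (Pi.single k 1) (Pi.single j 1)
    simp only [canFlip, Trho, Pi.zero_apply, mul_zero, zero_add, Finset.sum_const_zero,
      add_zero] at h1
    rw [h1, add_sub_cancel_left, sub_self] at h2
    simp [Pi.single_apply] at h2
    simp only [Finset.sum_sub_distrib] at h2 ⊢
    linarith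
  · rintro h ⟨x, y, u, v⟩ ⟨x', z, u', v'⟩ ⟨e1, e2, e3, e4⟩
    dsimp only at e1 e2 e3 e4
    subst e1
    have h2 := fun a => key_identity_aux (fun i b => pderivCoord (ρ a i) b x')
      (fun b j => ρ b j x') (fun i => ρ a i x') (fun i j k => c i j k x') y z
    simp only [h, sub_self, zero_mul, Finset.sum_const_zero] at h2
    simp only [canFlip, Trho, Prod.mk.injEq]
    refine ⟨trivial, funext e2, funext fun a => (e3 a).symm, funext fun a => ?_⟩
    have := h2 a
    simp only [e2, e3, e4, mul_add, Finset.sum_add_distrib]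
    linarith
end

section
/- Let ρ^a_i : ℝ^m → ℝ and c^k_{ij} : ℝ^m → ℝ be smooth with c^k_{ij} = −c^k_{ji}, and let κ be the induced local algebroid relation on TE = ℝ^m × ℝ^r × ℝ^m × ℝ^r. Then κ is symmetric: (X,Y) ∈ κ if and only if (Y,X) ∈ κ. -/
open scoped BigOperators

/-- The local algebroid relation `κ` is symmetric: `(X,Y) ∈ κ` iff `(Y,X) ∈ κ`.
(Part (a) of the Proposition on properties of `κ`.) -/
theorem kappaRel_symm {m r : ℕ}
    (ρ : Fin m → Fin r → (Fin m → ℝ) → ℝ)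
    (c : Fin r → Fin r → Fin r → (Fin m → ℝ) → ℝ)
    (hρ : ∀ a i, ContDiff ℝ (⊤ : ℕ∞) (ρ a i))
    (hc : ∀ k i j, ContDiff ℝ (⊤ : ℕ∞) (c k i j))
    (hskew : ∀ k i j x, c k i j x = - c k j i x) :
    ∀ X Y, kappaRel ρ c X Y ↔ kappaRel ρ c Y X := by
  have key : ∀ X Y, kappaRel ρ c X Y → kappaRel ρ c Y X := by
    rintro X Y ⟨h1, h2, h3, h4⟩
    refine ⟨h1.symm, ?_, ?_, ?_⟩
    · intro a
      rw [h1]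
      exact h3 a
    · intro a
      rw [h1]
      exact h2 a
    · intro k
      have hs : ∑ i, ∑ j, c k i j X.1 * X.2.1 i * Y.2.1 j
          = - ∑ i, ∑ j, c k i j X.1 * Y.2.1 i * X.2.1 j := by
        rw [Finset.sum_comm, ← Finset.sum_neg_distrib]
        refine Finset.sum_congr rfl fun i _ => ?_
        rw [← Finset.sum_neg_distrib]
        refine Finset.sum_congr rfl fun j _ => ?_
        rw [hskew k j i]
        ring
      rw [h1, hs, h4 k]
      ring
  exact fun X Y => ⟨key X Y, key Y X⟩
end

section
/- Let g be a finite-dimensional real Lie algebra, let k ≥ 1, let a : ℝ → g be smooth, and let ξ_0, …, ξ_{k−1} : ℝ → g* be smooth; set ξ_{−1} ≡ 0. Then for all t ∈ ℝ: ∑_{β=0}^{k} (−1)^β (d/dt)^β [ ξ_{β−1}(t) + ∑_{s=0}^{k−β−1} C(β+s,s) · ad*_{a^{(s)}(t)} ξ_{β+s}(t) ] = −(d/dt)[ ∑_{α=0}^{k−1} (−1)^α ξ_α^{(α)}(t) ] + ad*_{a(t)}[ ∑_{α=0}^{k−1} (−1)^α ξ_α^{(α)}(t) ], where a^{(s)}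 denotes the s-th derivative of a, ξ_α^{(α)} the α-th derivative of ξ_α, and C(n,r) the binomial coefficient. -/
open scoped BigOperators

/-- The coadjoint action `ad*_Y ξ` of a (finite-dimensional, normed) real Lie algebra `g`
— with Lie bracket given by the bilinear map `br` — on its dual:
`⟨ad*_Y ξ, X⟩ = ⟨ξ, [Y,X]⟩`. -/
noncomputable def coad {g : Type*} [NormedAddCommGroup g] [NormedSpace ℝ g]
    [FiniteDimensional ℝ g] (br : g →ₗ[ℝ] g →ₗ[ℝ] g) (Y : g) (ξ : g →L[ℝ] ℝ) : g →L[ℝ] ℝ :=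
  LinearMap.toContinuousLinearMap ((ξ : g →ₗ[ℝ] ℝ).comp (br Y))

lemma hep_iter_smooth {E : Type*} [NormedAddCommGroup E] [NormedSpace ℝ E]
    {f : ℝ → E} (hf : ContDiff ℝ (⊤ : ℕ∞) f) (n : ℕ) :
    ContDiff ℝ (⊤ : ℕ∞) (iteratedDeriv n f) := by
  induction n generalizing f with
  | zero => simpa using hf
  | succ n ih =>
    rw [iteratedDeriv_succ']
    exact ih (contDiff_infty_iff_deriv.1 hf).2

lemma hep_bil {E F G : Type*} [NormedAddCommGroup E] [NormedSpace ℝ E]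
    [NormedAddCommGroup F] [NormedSpace ℝ F] [NormedAddCommGroup G] [NormedSpace ℝ G]
    (B : E →L[ℝ] F →L[ℝ] G) {a : ℝ → E} {x : ℝ → F} (ha : ContDiff ℝ (⊤ : ℕ∞) a)
    (hx : ContDiff ℝ (⊤ : ℕ∞) x) : ContDiff ℝ (⊤ : ℕ∞) (fun τ => B (a τ) (x τ)) :=
  (B.contDiff.comp ha).clm_apply hx

lemma hep_key {E F G : Type*} [NormedAddCommGroup E] [NormedSpace ℝ E]
    [NormedAddCommGroup F] [NormedSpace ℝ F] [NormedAddCommGroup G] [NormedSpace ℝ G]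
    (B : E →L[ℝ] F →L[ℝ] G) (x : ℝ → F) (hx : ContDiff ℝ (⊤ : ℕ∞) x) (m : ℕ) :
    ∀ (a : ℝ → E), ContDiff ℝ (⊤ : ℕ∞) a → ∀ t : ℝ,
    ∑ p ∈ Finset.HasAntidiagonal.antidiagonal m, m.choose p.1 •
      ((-1 : ℝ) ^ p.2 • iteratedDeriv p.2 (fun τ => B (iteratedDeriv p.1 a τ) (x τ)) t)
      = (-1 : ℝ) ^ m • B (a t) (iteratedDeriv m x t) := by
  induction m with
  | zero => intro a ha t; simp
  | succ m ih =>
    intro a ha t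
    have hB : ∀ s, ContDiff ℝ (⊤ : ℕ∞) (fun τ => B (iteratedDeriv s a τ) (x τ)) := fun s =>
      (B.contDiff.comp (hep_iter_smooth ha s)).clm_apply hx
    rw [Finset.sum_antidiagonal_choose_succ_nsmul (fun i j =>
      ((-1 : ℝ) ^ j • iteratedDeriv j (fun τ => B (iteratedDeriv i a τ) (x τ)) t)) m]
    have h2 := ih (deriv a) (contDiff_infty_iff_deriv.1 ha).2 t
    simp only [← iteratedDeriv_succ'] at h2
    have h1 := congrArg (fun f => deriv f t) (funext (ih a ha))
    have da : HasDerivAt a (deriv a t) t := (ha.differentiable (by simp) t).hasDerivAt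
    have dx : HasDerivAt (iteratedDeriv m x) (iteratedDeriv (m+1) x t) t := by
      rw [iteratedDeriv_succ]
      exact ((hep_iter_smooth hx m).differentiable (by simp) t).hasDerivAt
    have dB : HasDerivAt (fun τ => (-1 : ℝ) ^ m • B (a τ) (iteratedDeriv m x τ))
        ((-1 : ℝ) ^ m • (B (deriv a t) (iteratedDeriv m x t)
          + B (a t) (iteratedDeriv (m+1) x t))) t :=
      ((B.hasFDerivAt.comp_hasDerivAt t da).clm_apply dx).const_smul _
    have dS : HasDerivAt (fun t => ∑ p ∈ Finset.HasAntidiagonal.antidiagonal m, m.choose p.1 •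
      ((-1 : ℝ) ^ p.2 • iteratedDeriv p.2 (fun τ => B (iteratedDeriv p.1 a τ) (x τ)) t))
      (∑ p ∈ Finset.HasAntidiagonal.antidiagonal m, m.choose p.1 •
      ((-1 : ℝ) ^ p.2 • iteratedDeriv (p.2+1) (fun τ => B (iteratedDeriv p.1 a τ) (x τ)) t)) t := by
      apply HasDerivAt.fun_sum
      intro p _
      rw [iteratedDeriv_succ]
      exact ((((hep_iter_smooth (hB p.1) p.2).differentiable
        (by simp) t).hasDerivAt).const_smul ((-1 : ℝ) ^ p.2)).const_smul (m.choose p.1)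
    simp only [dB.deriv, dS.deriv] at h1
    have e : ∀ p ∈ Finset.HasAntidiagonal.antidiagonal m, m.choose p.2 = m.choose p.1 := by
      intro p hp
      rw [Finset.HasAntidiagonal.mem_antidiagonal] at hp
      exact (Nat.choose_symm_of_eq_add hp.symm).symm
    have h3 : ∑ p ∈ Finset.HasAntidiagonal.antidiagonal m, m.choose p.2 • ((-1 : ℝ) ^ p.2 •
        iteratedDeriv p.2 (fun τ => B (iteratedDeriv (p.1+1) a τ) (x τ)) t)
        = (-1 : ℝ) ^ m • B (deriv a t) (iteratedDeriv m x t) := by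
      rw [← h2]
      exact Finset.sum_congr rfl (fun p hp => by rw [e p hp])
    rw [h3]
    simp only [pow_succ, mul_neg, mul_one, neg_smul, smul_neg, Finset.sum_neg_distrib, h1]
    simp only [smul_add]
    abel

lemma hep_sum {M : Type*} [AddCommMonoid M] (k : ℕ) (f : ℕ → ℕ → M) :
    ∑ β ∈ Finset.range (k + 1), ∑ s ∈ Finset.range (k - β), f β s
      = ∑ m ∈ Finset.range k, ∑ p ∈ Finset.HasAntidiagonal.antidiagonal m, f p.2 p.1 := by
  rw [Finset.sum_sigma', Finset.sum_sigma']
  refine Finset.sum_nbij' (fun q => ⟨q.1 + q.2, (q.2, q.1)⟩) (fun q => ⟨q.2.2, q.2.1⟩) ?_ ?_ ?_ ?_ ?_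
  · rintro ⟨b, s⟩ h
    simp at h ⊢
    omega
  · rintro ⟨m, i, j⟩ h
    simp at h ⊢
    omega
  · rintro ⟨b, s⟩ h
    rfl
  · rintro ⟨m, i, j⟩ h
    simp at h
    obtain ⟨h, rfl⟩ := h
    simp [add_comm]
  · rintro ⟨b, s⟩ h
    rfl

/-- The Euler–Lagrange force on a higher Lie algebra equals
`(−d/dt + ad*_{a(t)})` applied to `∑_α (−1)^α (d/dt)^α ξ_α`. -/
theorem higher_euler_poincare_force {g : Type*} [NormedAddCommGroup g] [NormedSpace ℝ g]
    [FiniteDimensional ℝ g]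
    -- the Lie bracket of g, as a bilinear map, skew-symmetric and satisfying Jacobi
    (br : g →ₗ[ℝ] g →ₗ[ℝ] g)
    (hskew : ∀ X Y : g, br X Y = - br Y X)
    (hjac : ∀ X Y Z : g, br X (br Y Z) = br (br X Y) Z + br Y (br X Z))
    (k : ℕ) (hk : 1 ≤ k)
    (a : ℝ → g) (ha : ContDiff ℝ (⊤ : ℕ∞) a)
    (ξ : ℕ → ℝ → (g →L[ℝ] ℝ)) (hξ : ∀ i < k, ContDiff ℝ (⊤ : ℕ∞) (ξ i))
    (t : ℝ) :
    ∑ β ∈ Finset.range (k + 1), (-1 : ℝ) ^ β •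
        iteratedDeriv β (fun τ =>
          (if β = 0 then 0 else ξ (β - 1) τ)
          + ∑ s ∈ Finset.range (k - β),
              ((β + s).choose s : ℝ) • coad br (iteratedDeriv s a τ) (ξ (β + s) τ)) t
      = - deriv (fun τ => ∑ α ∈ Finset.range k, (-1 : ℝ) ^ α • iteratedDeriv α (ξ α) τ) t
        + coad br (a t) (∑ α ∈ Finset.range k, (-1 : ℝ) ^ α • iteratedDeriv α (ξ α) t) := by
  obtain ⟨B, hB⟩ : ∃ B : g →L[ℝ] (g →L[ℝ] ℝ) →L[ℝ] (g →L[ℝ] ℝ), ∀ Y η, coad br Y η = B Y η := by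
    refine ⟨(ContinuousLinearMap.compL ℝ g g ℝ).flip.comp (LinearMap.toContinuousLinearMap
      ((LinearMap.toContinuousLinearMap (𝕜 := ℝ) (E := g) (F' := g)).toLinearMap.comp br)), ?_⟩
    intro Y η
    ext X
    simp [coad]
  simp only [hB]
  have hs : ∀ s, ∀ i < k, ContDiff ℝ (⊤ : ℕ∞) (fun τ => B (iteratedDeriv s a τ) (ξ i τ)) :=
    fun s i hi => hep_bil B (hep_iter_smooth ha s) (hξ i hi)
  have step : ∀ β ∈ Finset.range (k + 1), (-1 : ℝ) ^ β •
        iteratedDeriv β (fun τ =>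
          (if β = 0 then 0 else ξ (β - 1) τ)
          + ∑ s ∈ Finset.range (k - β),
              ((β + s).choose s : ℝ) • B (iteratedDeriv s a τ) (ξ (β + s) τ)) t
      = (-1 : ℝ) ^ β • iteratedDeriv β (fun τ => if β = 0 then 0 else ξ (β - 1) τ) t
        + ∑ s ∈ Finset.range (k - β), (β + s).choose s • ((-1 : ℝ) ^ β •
          iteratedDeriv β (fun τ => B (iteratedDeriv s a τ) (ξ (β + s) τ)) t) := by
    intro β hβ
    rw [Finset.mem_range] at hβ
    have c1 : ContDiff ℝ (⊤ : ℕ∞) (fun τ => if β = 0 then 0 else ξ (β - 1) τ) := by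
      split_ifs with h
      · exact contDiff_const
      · exact hξ _ (by omega)
    have c2 : ∀ s ∈ Finset.range (k - β), ContDiff ℝ (⊤ : ℕ∞)
        (fun τ => ((β + s).choose s : ℝ) • B (iteratedDeriv s a τ) (ξ (β + s) τ)) := by
      intro s hs'
      rw [Finset.mem_range] at hs'
      exact (hs s (β + s) (by omega)).const_smul _
    have le : ((β : ℕ) : WithTop ℕ∞) ≤ ((⊤ : ℕ∞) : WithTop ℕ∞) := by exact_mod_cast le_top
    rw [iteratedDeriv_fun_add (c1.of_le le).contDiffAt
      ((ContDiff.sum c2).of_le le).contDiffAt, smul_add,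
      iteratedDeriv_fun_sum (fun s h => ((c2 s h).of_le le).contDiffAt), Finset.smul_sum]
    congr 1
    refine Finset.sum_congr rfl fun s h => ?_
    rw [Finset.mem_range] at h
    rw [iteratedDeriv_fun_const_smul ((hs s (β + s) (by omega)).of_le le).contDiffAt,
      smul_comm, Nat.cast_smul_eq_nsmul]
  rw [Finset.sum_congr rfl step, Finset.sum_add_distrib]
  congr 1
  · have d : HasDerivAt (fun τ => ∑ α ∈ Finset.range k, (-1 : ℝ) ^ α • iteratedDeriv α (ξ α) τ)
        (∑ α ∈ Finset.range k, (-1 : ℝ) ^ α • iteratedDeriv (α + 1) (ξ α) t) t := by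
      apply HasDerivAt.fun_sum
      intro i hi
      rw [iteratedDeriv_succ]
      exact ((hep_iter_smooth (hξ i (Finset.mem_range.1 hi)) i).differentiable
        (by simp) t).hasDerivAt.const_smul ((-1 : ℝ) ^ i)
    rw [d.deriv, Finset.sum_range_succ']
    simp [pow_succ]
    rw [← Finset.sum_neg_distrib]
    exact Finset.sum_congr rfl fun i _ => by
      ext X
      simp only [ContinuousLinearMap.smul_apply, ContinuousLinearMap.neg_apply, smul_eq_mul, neg_mul]
  · rw [hep_sum k (fun β s => (β + s).choose s • ((-1 : ℝ) ^ β •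
          iteratedDeriv β (fun τ => B (iteratedDeriv s a τ) (ξ (β + s) τ)) t)), map_sum]
    refine Finset.sum_congr rfl fun m hm => ?_
    rw [map_smul, ← hep_key B (ξ m) (hξ m (Finset.mem_range.1 hm)) m a ha t]
    refine Finset.sum_congr rfl fun p hp => ?_
    rw [Finset.HasAntidiagonal.mem_antidiagonal, add_comm] at hp
    rw [hp]
end

section
/- Let g be a finite-dimensional real Lie algebra, let k ≥ 1, let a : ℝ → g be smooth, and let ξ_0, …, ξ_{k−1} : ℝ → g* be smooth. Then for all t ∈ ℝ: ∑_{β=0}^{k} ∑_{s=0}^{k−β−1} (−1)^β · C(β+s,s) · (d/dt)^β [ ad*_{a^{(s)}(t)} ξ_{β+s}(t) ] = ∑_{α=0}^{k−1} (−1)^α · ad*_{a(t)} ξ_α^{(α)}(t), where a^{(s)} denotes the s-th derivative of a, ξ_α^{(α)} the α-th derivative of ξ_α, and C(n,r) the binomial coefficient. -/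
open scoped BigOperators

theorem S2_aux_contDiff {F : Type*} [NormedAddCommGroup F] [NormedSpace ℝ F] {f : ℝ → F}
    (hf : ContDiff ℝ (⊤ : ℕ∞) f) (n : ℕ) : ContDiff ℝ (⊤ : ℕ∞) (iteratedDeriv n f) := by
  induction n with
  | zero => simpa using hf
  | succ n ih =>
    rw [iteratedDeriv_succ]
    exact ((contDiff_infty_iff_deriv).1 ih).2

theorem S2_aux {E F G : Type*} [NormedAddCommGroup E] [NormedSpace ℝ E]
    [NormedAddCommGroup F] [NormedSpace ℝ F] [NormedAddCommGroup G] [NormedSpace ℝ G]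
    (B : E →L[ℝ] F →L[ℝ] G) (ξ : ℝ → F) (hξ : ContDiff ℝ (⊤ : ℕ∞) ξ) (n : ℕ) :
    ∀ (a : ℝ → E), ContDiff ℝ (⊤ : ℕ∞) a → ∀ t : ℝ,
    ∑ p ∈ Finset.HasAntidiagonal.antidiagonal n, n.choose p.1 • ((-1 : ℝ) ^ p.1 •
        iteratedDeriv p.1 (fun τ => B (iteratedDeriv p.2 a τ) (ξ τ)) t)
      = (-1 : ℝ) ^ n • B (a t) (iteratedDeriv n ξ t) := by
  induction n with
  | zero => intro a ha t; simp
  | succ n ih =>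
    intro a ha t
    have ha' : ContDiff ℝ (⊤ : ℕ∞) (deriv a) := ((contDiff_infty_iff_deriv).1 ha).2
    rw [Finset.sum_antidiagonal_choose_succ_nsmul (fun i j => (-1 : ℝ) ^ i •
        iteratedDeriv i (fun τ => B (iteratedDeriv j a τ) (ξ τ)) t) n]
    have h1 := ih (deriv a) ha' t
    simp only [← iteratedDeriv_succ'] at h1
    rw [h1]
    have hsm : ∀ i j : ℕ, ContDiff ℝ (⊤ : ℕ∞)
        (iteratedDeriv i (fun τ => B (iteratedDeriv j a τ) (ξ τ))) := fun i j =>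
      S2_aux_contDiff ((B.contDiff.comp (S2_aux_contDiff ha j)).clm_apply hξ) i
    have hL : HasDerivAt (fun t => ∑ p ∈ Finset.HasAntidiagonal.antidiagonal n, n.choose p.1 • ((-1 : ℝ) ^ p.1 •
        iteratedDeriv p.1 (fun τ => B (iteratedDeriv p.2 a τ) (ξ τ)) t))
        (∑ p ∈ Finset.HasAntidiagonal.antidiagonal n, n.choose p.1 • ((-1 : ℝ) ^ p.1 •
        iteratedDeriv (p.1 + 1) (fun τ => B (iteratedDeriv p.2 a τ) (ξ τ)) t)) t := by
      apply HasDerivAt.fun_sum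
      intro p hp
      have := ((hsm p.1 p.2).differentiable (by simp) t).hasDerivAt
      rw [iteratedDeriv_succ]
      simp only [← Nat.cast_smul_eq_nsmul ℝ]
      exact (this.const_smul _).const_smul _
    have hR : HasDerivAt (fun t => (-1 : ℝ) ^ n • B (a t) (iteratedDeriv n ξ t))
        ((-1 : ℝ) ^ n • (B (deriv a t) (iteratedDeriv n ξ t)
          + B (a t) (iteratedDeriv (n+1) ξ t))) t := by
      have d1 := (ha.differentiable (by simp) t).hasDerivAt
      have d2 := ((S2_aux_contDiff hξ n).differentiable (by simp) t).hasDerivAt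
      rw [iteratedDeriv_succ]
      exact ((B.hasFDerivAt.comp_hasDerivAt t d1).clm_apply d2).const_smul _
    rw [funext (ih a ha)] at hL
    have h2 := hL.unique hR
    have h3 : ∑ p ∈ Finset.HasAntidiagonal.antidiagonal n, n.choose p.2 • ((-1 : ℝ) ^ (p.1 + 1) •
        iteratedDeriv (p.1 + 1) (fun τ => B (iteratedDeriv p.2 a τ) (ξ τ)) t)
        = - ∑ p ∈ Finset.HasAntidiagonal.antidiagonal n, n.choose p.1 • ((-1 : ℝ) ^ p.1 •
        iteratedDeriv (p.1 + 1) (fun τ => B (iteratedDeriv p.2 a τ) (ξ τ)) t) := by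
      rw [← Finset.sum_neg_distrib]
      refine Finset.sum_congr rfl fun p hp => ?_
      rw [Nat.choose_symm_of_eq_add (Finset.HasAntidiagonal.mem_antidiagonal.1 hp).symm, pow_succ]
      simp
    rw [h3, h2, pow_succ, smul_add]
    simp

/-- The summand `S₂` in the derivation of the higher-order Euler–Poincaré equations:
`∑_{β=0}^{k} ∑_{s=0}^{k−β−1} (−1)^β C(β+s,s) (d/dt)^β [ad*_{a^{(s)}(t)} ξ_{β+s}(t)]
  = ∑_{α=0}^{k−1} (−1)^α ad*_{a(t)} ξ_α^{(α)}(t)`. -/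
theorem higher_euler_poincare_S2 {g : Type*} [NormedAddCommGroup g] [NormedSpace ℝ g]
    [FiniteDimensional ℝ g]
    (br : g →ₗ[ℝ] g →ₗ[ℝ] g)
    (hskew : ∀ X Y : g, br X Y = - br Y X)
    (hjac : ∀ X Y Z : g, br X (br Y Z) = br (br X Y) Z + br Y (br X Z))
    (k : ℕ) (hk : 1 ≤ k)
    (a : ℝ → g) (ha : ContDiff ℝ (⊤ : ℕ∞) a)
    (ξ : ℕ → ℝ → (g →L[ℝ] ℝ)) (hξ : ∀ i < k, ContDiff ℝ (⊤ : ℕ∞) (ξ i))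
    (t : ℝ) :
    ∑ β ∈ Finset.range (k + 1), ∑ s ∈ Finset.range (k - β),
        ((-1 : ℝ) ^ β * ((β + s).choose s : ℝ)) •
          iteratedDeriv β (fun τ => coad br (iteratedDeriv s a τ) (ξ (β + s) τ)) t
      = ∑ α ∈ Finset.range k, (-1 : ℝ) ^ α • coad br (a t) (iteratedDeriv α (ξ α) t) := by
  let brc : g →L[ℝ] g →L[ℝ] g := LinearMap.toContinuousLinearMap
    ((LinearMap.toContinuousLinearMap (𝕜 := ℝ) (E := g) (F' := g)).toLinearMap ∘ₗ br)
  let B : g →L[ℝ] (g →L[ℝ] ℝ) →L[ℝ] (g →L[ℝ] ℝ) :=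
    (ContinuousLinearMap.compL ℝ g g ℝ).flip ∘L brc
  have hB : ∀ Y η, coad br Y η = B Y η := fun Y η => by
    ext X; simp [coad, B, brc]
  simp only [hB]
  rw [Finset.sum_range_succ]
  simp only [Nat.sub_self, Finset.range_zero, Finset.sum_empty, add_zero]
  rw [Finset.sum_sigma']
  have key : ∀ n ∈ Finset.range k, (-1 : ℝ) ^ n • B (a t) (iteratedDeriv n (ξ n) t) =
      ∑ p ∈ Finset.HasAntidiagonal.antidiagonal n, n.choose p.1 • ((-1 : ℝ) ^ p.1 •
        iteratedDeriv p.1 (fun τ => B (iteratedDeriv p.2 a τ) (ξ n τ)) t) := fun n hn =>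
    (S2_aux B (ξ n) (hξ n (Finset.mem_range.1 hn)) n a ha t).symm
  rw [Finset.sum_congr rfl key, Finset.sum_sigma']
  refine Finset.sum_bij' (fun x _ => ⟨x.1 + x.2, (x.1, x.2)⟩) (fun y _ => ⟨y.2.1, y.2.2⟩)
    ?_ ?_ ?_ ?_ ?_
  · rintro ⟨b, s⟩ h
    simp at h ⊢
    omega
  · rintro ⟨n, b, s⟩ h
    simp at h ⊢
    omega
  · rintro ⟨b, s⟩ h
    rfl
  · rintro ⟨n, b, s⟩ h
    simp at h
    obtain ⟨h1, rfl⟩ := h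
    rfl
  · rintro ⟨b, s⟩ h
    simp only
    rw [← Nat.cast_smul_eq_nsmul ℝ, smul_smul, mul_comm, Nat.choose_symm_add]
end

section
/- Let g be a finite-dimensional real Lie algebra, let k ≥ 1, let a_0, …, a_{k−1} ∈ g and ξ_0, …, ξ_{k−1} ∈ g*, and set ξ_{−1} = 0. Define ξ'_α = C(k−1,α)^{-1} · ξ_{k−1−α} for 0 ≤ α ≤ k−1; ξ^{(0,α)} = ξ'_α and ξ^{(1,α)} = ∑_{s=0}^{α} C(α,s) · ad*_{a_s} ξ'_{α−s} for 0 ≤ α ≤ k−1; and ζ^{(β)} = C(k,β)^{-1} · [ C(k−1,β)·ξ^{(0,β)} + C(k−1,β−1)·ξ^{(1,β−1)} ] for 0 ≤ β ≤ k, with the conventions C(k−1,k) = 0 and C(k−1,−1) = 0 (so the undefined terms ξ^{(0,k)} and ξ^{(1,−1)} do not occur). Then for every 0 ≤ β ≤ k: ζ^{(β)} = C(k,β)^{-1} · [ ξ_{k−1−β} + ∑_{s=0}^{β−1} C(k−β+s,s) · ad*_{a_s} ξ_{k−β+s} ]. -/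
open scoped BigOperators

/-- The coadjoint action `ad*_Y ξ` of a real Lie algebra `g` — with Lie bracket given by the
bilinear map `br` — on its dual space: `⟨ad*_Y ξ, X⟩ = ⟨ξ, [Y,X]⟩`. -/
def coadDual {g : Type*} [AddCommGroup g] [Module ℝ g]
    (br : g →ₗ[ℝ] g →ₗ[ℝ] g) (Y : g) (ξ : Module.Dual ℝ g) : Module.Dual ℝ g :=
  ξ.comp (br Y)

/-- The computation of the dual morphism `ε_k^g` on a higher Lie algebra:
with `ξ'_α = C(k−1,α)⁻¹ ξ_{k−1−α}`, `ξ^{(0,α)} = ξ'_α`,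
`ξ^{(1,α)} = ∑_{s=0}^{α} C(α,s) ad*_{a_s} ξ'_{α−s}` and
`ζ^{(β)} = C(k,β)⁻¹ [C(k−1,β) ξ^{(0,β)} + C(k−1,β−1) ξ^{(1,β−1)}]`
(with the conventions `C(k−1,k) = 0` and `C(k−1,−1) = 0`), one has
`ζ^{(β)} = C(k,β)⁻¹ [ξ_{k−1−β} + ∑_{s=0}^{β−1} C(k−β+s,s) ad*_{a_s} ξ_{k−β+s}]`
for all `0 ≤ β ≤ k`, where `ξ_{−1} = 0`. -/
theorem epsilon_k_formula {g : Type*} [AddCommGroup g] [Module ℝ g] [FiniteDimensional ℝ g]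
    (br : g →ₗ[ℝ] g →ₗ[ℝ] g)
    (hskew : ∀ X Y : g, br X Y = - br Y X)
    (hjac : ∀ X Y Z : g, br X (br Y Z) = br (br X Y) Z + br Y (br X Z))
    (k : ℕ) (hk : 1 ≤ k)
    (a : ℕ → g) (ξ : ℕ → Module.Dual ℝ g)
    -- ξ'_α = C(k−1,α)⁻¹ • ξ_{k−1−α}, for 0 ≤ α ≤ k−1
    (ξ' : ℕ → Module.Dual ℝ g)
    (hξ' : ∀ α ≤ k - 1, ξ' α = (((k - 1).choose α : ℝ))⁻¹ • ξ (k - 1 - α))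
    -- ξ^{(0,α)} = ξ'_α, for 0 ≤ α ≤ k−1
    (ξ0 : ℕ → Module.Dual ℝ g)
    (hξ0 : ∀ α ≤ k - 1, ξ0 α = ξ' α)
    -- ξ^{(1,α)} = ∑_{s=0}^{α} C(α,s) • ad*_{a_s} ξ'_{α−s}, for 0 ≤ α ≤ k−1
    (ξ1 : ℕ → Module.Dual ℝ g)
    (hξ1 : ∀ α ≤ k - 1, ξ1 α =
      ∑ s ∈ Finset.range (α + 1), (α.choose s : ℝ) • coadDual br (a s) (ξ' (α - s)))
    -- ζ^{(β)} = C(k,β)⁻¹ • [C(k−1,β) • ξ^{(0,β)} + C(k−1,β−1) • ξ^{(1,β−1)}], for 0 ≤ β ≤ k,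
    -- with C(k−1,k) = 0 and C(k−1,−1) = 0 (the term at β = 0 being absent)
    (ζ : ℕ → Module.Dual ℝ g)
    (hζ : ∀ β ≤ k, ζ β = ((k.choose β : ℝ))⁻¹ •
      (((k - 1).choose β : ℝ) • ξ0 β
        + if β = 0 then 0 else ((k - 1).choose (β - 1) : ℝ) • ξ1 (β - 1))) :
    ∀ β ≤ k, ζ β = ((k.choose β : ℝ))⁻¹ •
      ((if β = k then 0 else ξ (k - 1 - β))
        + ∑ s ∈ Finset.range β, (((k - β + s).choose s : ℝ)) • coadDual br (a s) (ξ (k - β + s))) := by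
  intro β hβ
  rw [hζ β hβ]
  obtain ⟨n, rfl⟩ : ∃ n, k = n + 1 := ⟨k - 1, by omega⟩
  simp only [Nat.add_sub_cancel] at *
  congr 2
  · by_cases h : β = n + 1
    · subst h
      simp
    · have hb : β ≤ n := by omega
      have hne : ((n.choose β : ℕ) : ℝ) ≠ 0 := by
        exact_mod_cast (Nat.choose_pos hb).ne'
      rw [if_neg h, hξ0 β hb, hξ' β hb, smul_smul, mul_inv_cancel₀ hne, one_smul]
  · rcases β with _ | b
    · simp
    · have hb : b ≤ n := by omega
      simp only [Nat.add_sub_cancel]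
      rw [if_neg (Nat.succ_ne_zero b), hξ1 b hb, Finset.smul_sum]
      refine Finset.sum_congr rfl fun s hs => ?_
      have hsb : s ≤ b := by
        have := Finset.mem_range.mp hs
        omega
      have e1 : n - (b - s) = n - b + s := by omega
      have e2 : n + 1 - (b + 1) + s = n - b + s := by omega
      have hne : ((n.choose (b - s) : ℕ) : ℝ) ≠ 0 := by
        exact_mod_cast (Nat.choose_pos (by omega : b - s ≤ n)).ne'
      have key : n.choose b * b.choose s = n.choose (b - s) * (n - b + s).choose s := by
        have h := Nat.choose_mul (n := n) (Nat.sub_le b s)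
        rw [Nat.choose_symm hsb, e1, Nat.sub_sub_self hsb] at h
        exact h
      have keyR : (n.choose b : ℝ) * (b.choose s : ℝ)
          = (n.choose (b - s) : ℝ) * ((n - b + s).choose s : ℝ) := by
        exact_mod_cast key
      have hc : ∀ (c : ℝ) (η : Module.Dual ℝ g),
          coadDual br (a s) (c • η) = c • coadDual br (a s) η := fun c η => rfl
      rw [hξ' (b - s) (by omega), hc, smul_smul, smul_smul, e1, e2, keyR]
      congr 1
      field_simp
end

section
/- Let k ≥ 1 and let p_0, …, p_k, ξ : ℝ → ℝ be smooth functions. Then for all t ∈ ℝ: ∑_{α=0}^{k} p_α(t)·ξ^{(α)}(t) = ( ∑_{α=0}^{k} (−1)^α · p_α^{(α)}(t) ) · ξ(t) + d/dt [ ∑_{γ=0}^{k−1} m_γ(t)·ξ^{(γ)}(t) ], where m_γ = ∑_{j=0}^{k−1−γ} (−1)^j · p_{j+γ+1}^{(j)} and f^{(i)} denotes the i-th derivative of f. -/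
open scoped BigOperators

/-- The scalar local form of the geometric integration-by-parts formula:
`∑_{α=0}^{k} p_α ξ^{(α)} = (∑_{α=0}^{k} (−1)^α p_α^{(α)}) ξ + d/dt[∑_{γ=0}^{k−1} m_γ ξ^{(γ)}]`
with `m_γ = ∑_{j=0}^{k−1−γ} (−1)^j p_{j+γ+1}^{(j)}`. -/
theorem scalar_integration_by_parts (k : ℕ) (hk : 1 ≤ k)
    (p : ℕ → ℝ → ℝ) (ξ : ℝ → ℝ)
    (hp : ∀ α ≤ k, ContDiff ℝ (⊤ : ℕ∞) (p α)) (hξ : ContDiff ℝ (⊤ : ℕ∞) ξ)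
    (t : ℝ) :
    ∑ α ∈ Finset.range (k + 1), p α t * iteratedDeriv α ξ t
      = (∑ α ∈ Finset.range (k + 1), (-1 : ℝ) ^ α * iteratedDeriv α (p α) t) * ξ t
        + deriv (fun τ => ∑ γ ∈ Finset.range k,
            (∑ j ∈ Finset.range (k - γ), (-1 : ℝ) ^ j * iteratedDeriv j (p (j + γ + 1)) τ)
              * iteratedDeriv γ ξ τ) t := by
  have hd : ∀ f : ℝ → ℝ, ContDiff ℝ (⊤ : ℕ∞) f → ∀ n : ℕ,
      HasDerivAt (iteratedDeriv n f) (iteratedDeriv (n + 1) f t) t := by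
    intro f hf n
    rw [iteratedDeriv_succ]
    exact ((hf.differentiable_iteratedDeriv n (by exact_mod_cast WithTop.coe_lt_top _)) t).hasDerivAt
  let M : ℕ → ℝ := fun γ =>
    ∑ j ∈ Finset.range (k + 1 - γ), (-1 : ℝ) ^ j * iteratedDeriv j (p (j + γ)) t
  have hm : ∀ γ ∈ Finset.range k, HasDerivAt
      (fun τ => ∑ j ∈ Finset.range (k - γ), (-1 : ℝ) ^ j * iteratedDeriv j (p (j + γ + 1)) τ)
      (p γ t - M γ) t := by
    intro γ hγ
    have hγ' := Finset.mem_range.1 hγ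
    have h := HasDerivAt.fun_sum (u := Finset.range (k - γ))
      (A := fun j τ => (-1 : ℝ) ^ j * iteratedDeriv j (p (j + γ + 1)) τ)
      (A' := fun j => (-1 : ℝ) ^ j * iteratedDeriv (j + 1) (p (j + γ + 1)) t) (x := t)
      (fun j hj => (hd _ (hp _ (by have := Finset.mem_range.1 hj; omega)) j).const_mul _)
    refine h.congr_deriv ?_
    symm
    have e : k + 1 - γ = (k - γ) + 1 := by omega
    simp only [M]
    rw [e, Finset.sum_range_succ']
    simp only [pow_zero, iteratedDeriv_zero, zero_add, one_mul, sub_add_cancel_right]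
    rw [← Finset.sum_neg_distrib]
    refine Finset.sum_congr rfl fun j _ => ?_
    rw [show j + 1 + γ = j + γ + 1 by omega]
    ring
  have hsum := HasDerivAt.fun_sum (fun γ hγ => (hm γ hγ).mul (hd ξ hξ γ))
  have hM : ∀ γ, ∑ j ∈ Finset.range (k - γ), (-1 : ℝ) ^ j * iteratedDeriv j (p (j + γ + 1)) t
      = M (γ + 1) := by
    intro γ
    simp only [M, Nat.add_sub_add_right, add_assoc]
  have hk' : M k = p k t := by simp [M]
  have h0 : M 0 = ∑ α ∈ Finset.range (k + 1), (-1 : ℝ) ^ α * iteratedDeriv α (p α) t := by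
    simp [M]
  have ht := Finset.sum_range_sub (fun γ => M γ * iteratedDeriv γ ξ t) k
  have hs : ∑ γ ∈ Finset.range k, ((p γ t - M γ) * iteratedDeriv γ ξ t
      + M (γ + 1) * iteratedDeriv (γ + 1) ξ t)
      = ∑ γ ∈ Finset.range k, p γ t * iteratedDeriv γ ξ t
        + (M k * iteratedDeriv k ξ t - M 0 * iteratedDeriv 0 ξ t) := by
    rw [← ht, ← Finset.sum_add_distrib]
    exact Finset.sum_congr rfl fun _ _ => by ring
  simp only [hM] at hsum
  rw [hs] at hsum
  have hfin := hsum.deriv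
  simp only [Pi.mul_apply] at hfin
  rw [hfin, ← h0, Finset.sum_range_succ, hk', iteratedDeriv_zero]
  ring
end
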